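/- Virtual delay bound for a packetized constant bit rate server with token-bucket constrained input: let c > 0, let packets n = 1, 2, ... arrive at times 0 ≤ a(1) ≤ a(2) ≤ ... with lengths 0 < l(n) ≤ l^M, served with d(0) = 0 and d(n) = max(a(n), d(n − 1)) + l(n)/c; let A(t) = Σ_{n : a(n) < t} l(n) and A*(t) = Σ_{n : d(n) < t} l(n), and define the virtual delay D(t) = inf{ τ ≥ 0 : A(t) ≤ A*(t + τ) }. If A(t) − A(s) ≤ ρ·(t − s) + σ for all 0 ≤ s ≤ t with 0 ≤ ρ ≤ c and σ ≥ 0, then for all t ≥ 0, D(t) ≤ (σ + l^M)/c. -/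

import Mathlib

/-- Departure times of a packetized work-conserving FIFO server of constant bit
rate `c`: `d(0) = 0` and `d(n+1) = max(a(n+1), d(n)) + l(n+1)/c`, where `a` gives
the times the packets become available and `len` their lengths. -/
noncomputable def dep (c : ℝ) (a len : ℕ → ℝ) : ℕ → ℝ
  | 0 => 0
  | n + 1 => max (a (n + 1)) (dep c a len n) + len (n + 1) / c

lemma sum_range_le_mul_dep {c : ℝ} (hc : 0 < c) (a len : ℕ → ℝ) (hlen0 : len 0 = 0) (n : ℕ) :
    ∑ i ∈ Finset.range (n + 1), len i ≤ c * dep c a len n := by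
  induction n with
  | zero => simp [dep, hlen0]
  | succ n ih =>
    have hle : dep c a len n ≤ max (a (n + 1)) (dep c a len n) := le_max_right _ _
    have hcl : c * (len (n + 1) / c) = len (n + 1) := by field_simp
    rw [Finset.sum_range_succ, dep, mul_add, hcl]
    linarith [mul_le_mul_of_nonneg_left hle hc.le]

lemma summable_departed {c : ℝ} (hc : 0 < c) (a len : ℕ → ℝ) (hlen0 : len 0 = 0)
    (hlen : ∀ n, 0 ≤ len n) (T : ℝ) :
    Summable fun n => if dep c a len n < T then len n else 0 := by
  refine summable_of_sum_range_le (c := c * max T 0) (fun n => ?_) fun m => ?_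
  · split_ifs
    exacts [hlen n, le_rfl]
  · induction m with
    | zero => simpa using mul_nonneg hc.le (le_max_right T 0)
    | succ m ih =>
      by_cases h : dep c a len m < T
      · calc ∑ i ∈ Finset.range (m + 1), (if dep c a len i < T then len i else 0)
            ≤ ∑ i ∈ Finset.range (m + 1), len i := by
              refine Finset.sum_le_sum fun i _ => ?_
              split_ifs
              exacts [le_rfl, hlen i]
          _ ≤ c * dep c a len m := sum_range_le_mul_dep hc a len hlen0 m
          _ ≤ c * max T 0 :=
              mul_le_mul_of_nonneg_left (h.le.trans (le_max_left _ _)) hc.le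
      · rw [Finset.sum_range_succ, if_neg h, add_zero]
        exact ih

/-- Every departure time is the start of a busy period plus the service time of the packets
of that busy period. -/
lemma exists_dep_eq_busy_period (c : ℝ) (a len : ℕ → ℝ) (ha1 : 0 ≤ a 1) (n : ℕ) (hn : 1 ≤ n) :
    ∃ k, 1 ≤ k ∧ k ≤ n ∧ dep c a len n = a k + (∑ j ∈ Finset.Icc k n, len j) / c := by
  induction n, hn using Nat.le_induction with
  | base => exact ⟨1, le_rfl, le_rfl, by simp [dep, ha1]⟩
  | succ n hn ih =>
    rcases le_total (dep c a len n) (a (n + 1)) with h | h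
    · exact ⟨n + 1, by lia, le_rfl, by simp [dep, h]⟩
    · obtain ⟨k, hk1, hkn, hk⟩ := ih
      refine ⟨k, hk1, by lia, ?_⟩
      rw [dep, max_eq_right h, hk, Finset.sum_Icc_succ_top (by lia), add_div, add_assoc]

/-- If the work arriving in `[a k, t)` is at most `c * (t - a k) + σ` for every `k`, then every
packet arriving before `t` has departed by `t + σ / c`. -/
lemma dep_le_of_arrivals_le {c σ t : ℝ} (hc : 0 < c) (a len : ℕ → ℝ) (ha1 : 0 ≤ a 1)
    (hamono : ∀ i j, 1 ≤ i → i ≤ j → a i ≤ a j) (hlen : ∀ n, 0 ≤ len n)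
    (hsum : Summable fun n => if a n < t then len n else 0)
    (harr : ∀ k, 1 ≤ k → a k ≤ t → (∑' n, if a n < t then len n else 0) -
      (∑' n, if a n < a k then len n else 0) ≤ c * (t - a k) + σ)
    (n : ℕ) (hn : 1 ≤ n) (hnt : a n < t) : dep c a len n ≤ t + σ / c := by
  obtain ⟨k, hk1, hkn, hk⟩ := exists_dep_eq_busy_period c a len ha1 n hn
  have hkt : a k < t := (hamono k n hk1 hkn).trans_lt hnt
  have hle (j : ℕ) : (if a j < a k then len j else 0) ≤ if a j < t then len j else 0 := by
    have := hlen j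
    split_ifs <;> linarith
  have hsumk : Summable fun j => if a j < a k then len j else 0 := by
    refine Summable.of_nonneg_of_le (fun j => ?_) hle hsum
    split_ifs
    exacts [hlen j, le_rfl]
  have hwork : ∑ j ∈ Finset.Icc k n, len j ≤ c * (t - a k) + σ := by
    refine le_trans ?_ (harr k hk1 hkt.le)
    rw [← hsum.tsum_sub hsumk]
    refine le_trans (Finset.sum_le_sum fun j hj => ?_)
      ((hsum.sub hsumk).sum_le_tsum (Finset.Icc k n) fun j _ => sub_nonneg.2 (hle j))
    obtain ⟨hkj, hjn⟩ := Finset.mem_Icc.1 hj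
    rw [if_pos ((hamono j n (hk1.trans hkj) hjn).trans_lt hnt),
      if_neg (hamono k j hk1 hkj).not_gt, sub_zero]
  have hdiv := div_le_div_of_nonneg_right hwork hc.le
  rw [add_div, mul_div_cancel_left₀ _ hc.ne'] at hdiv
  linarith

/-- Virtual delay bound for a packetized constant bit rate server
with token-bucket constrained input: if the input satisfies
`A(t) − A(s) ≤ ρ·(t − s) + σ` for all `0 ≤ s ≤ t` with `0 ≤ ρ ≤ c` and `σ ≥ 0`,
then the virtual delay `D(t) = inf{τ ≥ 0 : A(t) ≤ A*(t + τ)}` satisfies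
`D(t) ≤ (σ + l^M)/c` for all `t ≥ 0`. -/
theorem virtual_delay_bound_CBR
    (c lM ρ σ : ℝ) (hc : 0 < c)
    (a len : ℕ → ℝ)
    (ha1 : 0 ≤ a 1) (hamono : ∀ n, 1 ≤ n → a n ≤ a (n + 1))
    (hlen0 : len 0 = 0)
    (hlen : ∀ n, 1 ≤ n → 0 < len n ∧ len n ≤ lM)
    (A Astar D : ℝ → ℝ)
    (hA : ∀ t, A t = ∑' n : ℕ, if a n < t then len n else 0)
    (hAstar : ∀ t, Astar t = ∑' n : ℕ, if dep c a len n < t then len n else 0)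
    (hD : ∀ t, D t = sInf {τ : ℝ | 0 ≤ τ ∧ A t ≤ Astar (t + τ)})
    (hρ0 : 0 ≤ ρ) (hρc : ρ ≤ c) (hσ : 0 ≤ σ)
    (harr : ∀ s t, 0 ≤ s → s ≤ t → A t - A s ≤ ρ * (t - s) + σ) :
    ∀ t, 0 ≤ t → D t ≤ (σ + lM) / c := by
  intro t ht
  have hlM : 0 ≤ lM := (hlen 1 le_rfl).1.le.trans (hlen 1 le_rfl).2
  have hlen' (n : ℕ) : 0 ≤ len n := by
    rcases n.eq_zero_or_pos with rfl | hn
    exacts [hlen0.ge, (hlen n hn).1.le]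
  have hamono' (i j : ℕ) (hi : 1 ≤ i) (hij : i ≤ j) : a i ≤ a j := by
    induction j, hij using Nat.le_induction with
    | base => exact le_rfl
    | succ j hij ih => exact ih.trans (hamono j (hi.trans hij))
  have hbdd : BddBelow {τ : ℝ | 0 ≤ τ ∧ A t ≤ Astar (t + τ)} := ⟨0, fun _ h => h.1⟩
  rw [hD]
  by_cases hsum : Summable fun n => if a n < t then len n else 0
  · have hdep (n : ℕ) (hn : 1 ≤ n) (hnt : a n < t) : dep c a len n ≤ t + σ / c := by
      refine dep_le_of_arrivals_le hc a len ha1 hamono' hlen' hsum (fun k hk hkt => ?_)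
        n hn hnt
      rw [← hA, ← hA]
      refine (harr _ _ (ha1.trans (hamono' 1 k le_rfl hk)) hkt).trans ?_
      gcongr
    refine le_trans ?_ (div_le_div_of_nonneg_right (le_add_of_nonneg_right hlM) hc.le)
    refine le_of_forall_pos_le_add fun ε hε => csInf_le hbdd ⟨by positivity, ?_⟩
    rw [hA, hAstar]
    refine hsum.tsum_le_tsum (fun n => ?_) (summable_departed hc a len hlen0 hlen' _)
    rcases n.eq_zero_or_pos with rfl | hn
    · simp [hlen0]
    · by_cases hnt : a n < t
      · rw [if_pos hnt, if_pos (by linarith [hdep n hn hnt])]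
      · rw [if_neg hnt]
        split_ifs
        exacts [hlen' n, le_rfl]
  · refine (csInf_le hbdd ⟨le_rfl, ?_⟩).trans (div_nonneg (add_nonneg hσ hlM) hc.le)
    rw [hA, hAstar, tsum_eq_zero_of_not_summable hsum]
    refine tsum_nonneg fun n => ?_
    split_ifs
    exacts [hlen' n, le_rfl]
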